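/- For every integer n ≥ 1 and every real ξ > 0, the n×n tridiagonal matrix with first diagonal entry cosh(ξ), remaining diagonal entries 2·cosh(ξ), and sub/super-diagonal entries 1, is positive definite. -/

import Mathlib

open Real

def auxM (c : ℝ) (i j : ℕ) : ℝ :=
  if i = j then (if i = 0 then c else 2 * c)
  else if i + 1 = j ∨ j + 1 = i then (1 : ℝ) else 0

theorem auxM_symm (c : ℝ) (i j : ℕ) : auxM c i j = auxM c j i := by
  unfold auxM
  grind

theorem auxM_row (c : ℝ) (y : ℕ → ℝ) (n : ℕ) :
    ∑ j ∈ Finset.range (n + 1), y (n + 1) * auxM c (n + 1) j * y j = y (n + 1) * y n := by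
  rw [Finset.sum_range_succ, Finset.sum_eq_zero]
  · simp [auxM]
  · intro j hj
    have hj' := Finset.mem_range.1 hj
    have : auxM c (n + 1) j = 0 := by
      unfold auxM
      rw [if_neg (by omega), if_neg (by omega)]
    simp [this]

theorem auxM_bound (c : ℝ) (hc : 1 < c) (y : ℕ → ℝ) (n : ℕ) :
    y n ^ 2 + (c - 1) * ∑ i ∈ Finset.range (n + 1), y i ^ 2 ≤
      ∑ i ∈ Finset.range (n + 1), ∑ j ∈ Finset.range (n + 1), y i * auxM c i j * y j := by
  induction n with
  | zero => simp [auxM]; nlinarith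
  | succ n ih =>
    have h1 := auxM_row c y n
    have h2 : ∑ i ∈ Finset.range (n + 1), y i * auxM c i (n + 1) * y (n + 1)
        = y (n + 1) * y n := by
      rw [← h1]
      refine Finset.sum_congr rfl fun i _ => ?_
      rw [auxM_symm c i]; ring
    have h3 : auxM c (n + 1) (n + 1) = 2 * c := by simp [auxM]
    rw [Finset.sum_range_succ _ (n + 1), Finset.sum_range_succ _ (n + 1)]
    simp_rw [Finset.sum_range_succ _ (n + 1)]
    rw [Finset.sum_add_distrib, h1, h2, h3]
    nlinarith [sq_nonneg (y (n + 1) + y n),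
      mul_nonneg (sub_nonneg.2 hc.le) (sq_nonneg (y (n + 1)))]

theorem stmt_8 (n : ℕ) (hn : 1 ≤ n) (ξ : ℝ) (hξ : 0 < ξ) :
    (Matrix.of (fun i j : Fin n =>
      if (i : ℕ) = j then (if (i : ℕ) = 0 then Real.cosh ξ else 2 * Real.cosh ξ)
      else if (i : ℕ) + 1 = j ∨ (j : ℕ) + 1 = i then (1 : ℝ) else 0)).PosDef := by
  have hc : 1 < Real.cosh ξ := Real.one_lt_cosh.2 hξ.ne'
  obtain ⟨m, rfl⟩ : ∃ m, n = m + 1 := ⟨n - 1, by omega⟩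
  change (Matrix.of (fun i j : Fin (m + 1) => auxM (Real.cosh ξ) i j)).PosDef
  refine ⟨?_, fun x hx => ?_⟩
  · ext i j
    simp [auxM_symm _ (j : ℕ)]
  · obtain ⟨k, hk⟩ : ∃ k, x k ≠ 0 := by simpa [Finsupp.ext_iff] using hx
    let y : ℕ → ℝ := fun i => if h : i < m + 1 then x ⟨i, h⟩ else 0
    have hy : ∀ i : Fin (m + 1), y i = x i := fun i => dif_pos i.2
    have hb := auxM_bound _ hc y m
    have hpos : 0 < ∑ i ∈ Finset.range (m + 1), y i ^ 2 :=
      Finset.sum_pos' (fun _ _ => sq_nonneg _)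
        ⟨k, Finset.mem_range.2 k.2, by rw [hy]; positivity⟩
    have hgt := (by nlinarith [sq_nonneg (y m), mul_pos (sub_pos.2 hc) hpos] :
      0 < ∑ i ∈ Finset.range (m + 1), ∑ j ∈ Finset.range (m + 1),
        y i * auxM (Real.cosh ξ) i j * y j)
    simp_rw [Finset.sum_range, hy] at hgt
    rw [Finsupp.sum_fintype _ _ (by simp)]
    simp_rw [Finsupp.sum_fintype x _ (fun _ => mul_zero _)]
    simpa using hgt
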